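/- Let t ≥ 3, k1 > k2 ≥ ... ≥ kt ≥ 2 and k1 + k3 ≤ n < k1 + k2, and let (ℱ1,...,ℱt) be an extremal (n,k1,...,kt)-cross intersecting system in which every ℱi is L-initial with ID Ii. If {1, n−k1+2, ..., n} ⪵ I1 ⪵ {kt, n−k1+2, ..., n} and {1, n−k2+2, ..., n} ⪵ I2 ⪵ {kt, n−k2+2, ..., n}, then Σ_{i=1}^t |ℱi| < max{λ1, λ2}. -/

import Mathlib

open Finset

attribute [local instance] Classical.propDecidable

noncomputable section

/-- The ground set `[n] = {1, …, n}`. -/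
def ground (n : ℕ) : Finset ℕ := Finset.Icc 1 n

/-- `C([n], k)`: the family of all `k`-element subsets of `[n]`. -/
def ksubsets (n k : ℕ) : Finset (Finset ℕ) := Finset.powersetCard k (ground n)

/-- Two families are cross intersecting. -/
def CrossInt (A B : Finset (Finset ℕ)) : Prop :=
  ∀ a ∈ A, ∀ b ∈ B, (a ∩ b).Nonempty

/-- The lexicographic order `A ≺ B`:  `A ⊇ B` or `min (A ∖ B) < min (B ∖ A)`. -/
def lex (A B : Finset ℕ) : Prop :=
  B ⊆ A ∨ (A \ B).min < (B \ A).min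

/-- Strict lexicographic order `A ⪵ B`. -/
def lexLT (A B : Finset ℕ) : Prop := lex A B ∧ A ≠ B

/-- `L(R, k)` over `[n]`: all `k`-subsets of `[n]` that are `≺ R`. -/
def Lset (n : ℕ) (R : Finset ℕ) (k : ℕ) : Finset (Finset ℕ) :=
  (ksubsets n k).filter fun F => lex F R

/-- `L(r, k)`: the first `r` elements of `C([n], k)` in lexicographic order. -/
def Lnum (n r k : ℕ) : Finset (Finset ℕ) :=
  (ksubsets n k).filter fun F => ((ksubsets n k).filter fun G => lex G F).card ≤ r

/-- A family is L-initial if it equals `L(R, k)` for some `k`-set `R` (an ID of the family). -/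
def LInitial (n k : ℕ) (A : Finset (Finset ℕ)) : Prop :=
  ∃ R ∈ ksubsets n k, A = Lset n R k

/-- `F` and `H` strongly intersect at their last element; `H` is the partner of `F`
(and `F` is the partner of `H`). -/
def IsPartner (F H : Finset ℕ) : Prop :=
  ∃ q, F ∩ H = {q} ∧ F ∪ H = Finset.Icc 1 q

/-- `K` is the `k`-partner of `F` (inside `[n]`). -/
def IsKPartner (n k : ℕ) (F K : Finset ℕ) : Prop :=
  ∃ H, IsPartner F H ∧
    ((k = H.card ∧ K = H) ∨
     (H.card < k ∧ K = H ∪ Finset.Icc (n - k + H.card + 1) n) ∨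
     (k < H.card ∧ K ∈ ksubsets n k ∧ lex K H ∧
        ∀ K' ∈ ksubsets n k, lex K' H → lex K' K))

/-- `ℓ(F)`: the largest `x` with `{n - x + 1, …, n} ⊆ F` (and `0` if there is none). -/
def ell (n : ℕ) (F : Finset ℕ) : ℕ :=
  ((Finset.range (n + 1)).filter fun x => Finset.Icc (n - x + 1) n ⊆ F).sup id

/-- `F^t = {n - ℓ(F) + 1, …, n}` (which is `∅` when `ℓ(F) = 0`). -/
def tailPart (n : ℕ) (F : Finset ℕ) : Finset ℕ := Finset.Icc (n - ell n F + 1) n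

/-- Maximal cross intersecting families. -/
def MaximalCross (n f g : ℕ) (F G : Finset (Finset ℕ)) : Prop :=
  F ⊆ ksubsets n f ∧ G ⊆ ksubsets n g ∧ CrossInt F G ∧
    ∀ F' G' : Finset (Finset ℕ), F ⊆ F' → F' ⊆ ksubsets n f →
      G ⊆ G' → G' ⊆ ksubsets n g → CrossInt F' G' → F = F' ∧ G = G'

/-- The pair of sets `(F, G)` is maximal. -/
def PairMaximal (n : ℕ) (F G : Finset ℕ) : Prop :=
  MaximalCross n F.card G.card (Lset n F F.card) (Lset n G G.card)

/-- Maximal pair families. -/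
def MaximalPairFamilies (n : ℕ) (A1 A2 : Finset (Finset ℕ)) : Prop :=
  A1.card = A2.card ∧ ∀ a1 ∈ A1, ∃! a2, a2 ∈ A2 ∧ PairMaximal n a1 a2

/-- `H1` is the `|H1|`-parity of `H2` (intended for `|H1| ≤ |H2|`):
`H1 ∖ H1^t = H2 ∖ H2^t` and `ℓ(H2) - ℓ(H1) = |H2| - |H1|`. -/
def IsParity (n : ℕ) (H1 H2 : Finset ℕ) : Prop :=
  H1 \ tailPart n H1 = H2 \ tailPart n H2 ∧
    ell n H2 + H1.card = ell n H1 + H2.card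

/-- The family `H1` of `h1`-sets is the `h1`-parity of the family `H2` of `h2`-sets. -/
def FamParity (n h1 h2 : ℕ) (H1 H2 : Finset (Finset ℕ)) : Prop :=
  (∀ A ∈ H1, ∃ B ∈ ksubsets n h2, IsParity n A B ∧ B ∈ H2) ∧
  (∀ B ∈ H2, ∀ A ∈ ksubsets n h1, IsParity n A B → A ∈ H1)

/-- An `(n, k 0, …, k (t-1))`-cross intersecting system:  non-empty pairwise
cross intersecting families `F i ⊆ C([n], k i)`. -/
def IsCIS (n : ℕ) {t : ℕ} (k : Fin t → ℕ) (F : Fin t → Finset (Finset ℕ)) : Prop :=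
  (∀ i, F i ⊆ ksubsets n (k i)) ∧ (∀ i, (F i).Nonempty) ∧
    ∀ i j : Fin t, i < j → CrossInt (F i) (F j)

/-- An extremal cross intersecting system. -/
def Extremal (n : ℕ) {t : ℕ} (k : Fin t → ℕ) (F : Fin t → Finset (Finset ℕ)) : Prop :=
  IsCIS n k F ∧ ∀ G : Fin t → Finset (Finset ℕ), IsCIS n k G →
    ∑ i, (G i).card ≤ ∑ i, (F i).card

/-- Two systems of families are isomorphic via a permutation of the ground set `[n]`. -/
def IsoSystems (n : ℕ) {t : ℕ} (F G : Fin t → Finset (Finset ℕ)) : Prop :=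
  ∃ σ : Equiv.Perm ℕ, (∀ x ∈ ground n, σ x ∈ ground n) ∧
    ∀ i, F i = (G i).image fun s => s.image ⇑σ

/-- The family `ℛ₂`. -/
def R2fam (n k2 kt : ℕ) : Finset (Finset ℕ) :=
  (ksubsets n k2).filter fun R =>
    lex (insert 1 (Finset.Icc (n - k2 + 2) n)) R ∧
    lex R (insert kt (Finset.Icc (n - k2 + 2) n))

/-- The family `ℱ₂,₃`. -/
def F23 (n k2 k3 kt : ℕ) : Finset (Finset ℕ) :=
  (R2fam n k2 kt).filter fun A => ∃ B ∈ ksubsets n k3, PairMaximal n A B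

/-- The total weight of all subsets of an `N`-element set, when an `l`-set has weight `W l`. -/
def cubeWeight (W : ℕ → ℤ) (N : ℕ) : ℤ := ∑ l ∈ range (N + 1), (N.choose l : ℤ) * W l

/-- The total weight of the lexicographic initial segment of a cube ending at the vertex
with indicator list `P`. -/
def segWeight (W : ℕ → ℤ) : List Bool → ℤ
  | [] => W 0
  | true :: P => segWeight (fun l => W (l + 1)) P
  | false :: P => cubeWeight (fun l => W (l + 1)) P.length + segWeight W P

/-- The weights are nonnegative below `θ` and nonpositive above `θ`. -/
def SignChange (θ : ℤ) (W : ℕ → ℤ) : Prop :=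
  ∀ l : ℕ, ((l : ℤ) < θ → 0 ≤ W l) ∧ (θ < (l : ℤ) → W l ≤ 0)

/-- Some `q`-set of the cube lies outside the initial segment ending at `P`. -/
def MissesLevel : ℕ → List Bool → Prop
  | _, [] => False
  | q, true :: P => q ≤ P.length ∨ ∃ r, q = r + 1 ∧ MissesLevel r P
  | q, false :: P => MissesLevel q P

theorem SignChange.shift {θ : ℤ} {W : ℕ → ℤ} (h : SignChange θ W) :
    SignChange (θ - 1) (fun l => W (l + 1)) := by
  intro l
  have := h (l + 1)
  push_cast at this
  exact ⟨fun hl => this.1 (by linarith), fun hl => this.2 (by linarith)⟩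

theorem SignChange.shift_add {θ : ℤ} {W : ℕ → ℤ} (h : SignChange θ W) (a : ℕ) :
    SignChange (θ - a) (fun l => W (l + a)) := by
  intro l
  have := h (l + a)
  push_cast at this
  exact ⟨fun hl => this.1 (by linarith), fun hl => this.2 (by linarith)⟩

theorem cubeWeight_succ_mul (W : ℕ → ℤ) (N : ℕ) :
    ((N : ℤ) + 1) * cubeWeight (fun l => W (l + 1)) N =
      ∑ l ∈ range (N + 2), (l : ℤ) * (((N + 1).choose l : ℤ) * W l) := by
  rw [Finset.sum_range_succ' _ (N + 1)]
  simp only [cubeWeight, Finset.mul_sum]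
  simp only [Nat.cast_zero, zero_mul, add_zero]
  refine Finset.sum_congr rfl fun l _ => ?_
  have h := Nat.add_one_mul_choose_eq N l
  have h' : ((N : ℤ) + 1) * (N.choose l : ℤ) = ((N + 1).choose (l + 1) : ℤ) * ((l : ℤ) + 1) := by
    exact_mod_cast h
  rw [← mul_assoc, h']
  push_cast
  ring

theorem cubeWeight_succ (W : ℕ → ℤ) (N : ℕ) :
    cubeWeight W (N + 1) = cubeWeight (fun l => W (l + 1)) N + cubeWeight W N := by
  simp only [cubeWeight]
  rw [Finset.sum_range_succ' _ (N + 1)]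
  rw [show ∑ l ∈ range (N + 1), (N.choose l : ℤ) * W l
      = ∑ l ∈ range (N + 2), (N.choose l : ℤ) * W l by
    rw [Finset.sum_range_succ _ (N + 1)]; simp]
  rw [Finset.sum_range_succ' (fun l => (N.choose l : ℤ) * W l) (N + 1), ← add_assoc,
    ← Finset.sum_add_distrib]
  congr 1
  · refine Finset.sum_congr rfl fun l _ => ?_
    rw [Nat.choose_succ_succ]
    push_cast
    ring
  · simp

/-- The first moment of the weight about `θ`. -/
def momentAbout (θ : ℤ) (W : ℕ → ℤ) (N : ℕ) : ℤ :=
  ∑ l ∈ range (N + 1), (θ - l) * ((N.choose l : ℤ) * W l)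

theorem cubeWeight_in_eq (θ : ℤ) (W : ℕ → ℤ) (N : ℕ) :
    ((N : ℤ) + 1) * cubeWeight (fun l => W (l + 1)) N =
      θ * cubeWeight W (N + 1) - momentAbout θ W (N + 1) := by
  rw [cubeWeight_succ_mul]
  simp only [cubeWeight, momentAbout, Finset.mul_sum, ← Finset.sum_sub_distrib]
  exact Finset.sum_congr rfl fun l _ => by ring

theorem cubeWeight_out_eq (θ : ℤ) (W : ℕ → ℤ) (N : ℕ) :
    ((N : ℤ) + 1) * cubeWeight W N =
      (N + 1 - θ) * cubeWeight W (N + 1) + momentAbout θ W (N + 1) := by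
  have h := cubeWeight_in_eq θ W N
  have h2 := cubeWeight_succ W N
  linear_combination (-(N : ℤ) - 1) * h2 - h

theorem SignChange.term_nonneg {θ : ℤ} {W : ℕ → ℤ} (h : SignChange θ W) (N l : ℕ) :
    0 ≤ (θ - l) * ((N.choose l : ℤ) * W l) := by
  have hc : (0 : ℤ) ≤ N.choose l := by positivity
  rcases lt_trichotomy (l : ℤ) θ with hl | hl | hl
  · exact mul_nonneg (by linarith) (mul_nonneg hc ((h l).1 hl))
  · simp [hl]
  · exact mul_nonneg_of_nonpos_of_nonpos (by linarith)
      (mul_nonpos_of_nonneg_of_nonpos hc ((h l).2 hl))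

theorem SignChange.moment_nonneg {θ : ℤ} {W : ℕ → ℤ} (h : SignChange θ W) (N : ℕ) :
    0 ≤ momentAbout θ W N :=
  Finset.sum_nonneg fun l _ => h.term_nonneg N l

theorem SignChange.moment_pos {θ : ℤ} {W : ℕ → ℤ} (h : SignChange θ W) {N q : ℕ}
    (hq : θ < q) (hqN : q ≤ N) (hW : W q < 0) : 0 < momentAbout θ W N := by
  refine Finset.sum_pos' (fun l _ => h.term_nonneg N l) ⟨q, by simp; omega, ?_⟩
  have hc : (0 : ℤ) < N.choose q := by exact_mod_cast Nat.choose_pos hqN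
  exact mul_pos_of_neg_of_neg (by linarith) (mul_neg_of_pos_of_neg hc hW)

theorem SignChange.in_nonpos {θ : ℤ} {W : ℕ → ℤ} (h : SignChange θ W) {N : ℕ}
    (hN : cubeWeight W (N + 1) ≤ 0) : cubeWeight (fun l => W (l + 1)) N ≤ 0 := by
  rcases le_or_gt 0 θ with hθ | hθ
  · have h1 := cubeWeight_in_eq θ W N
    have h2 := h.moment_nonneg (N + 1)
    have h3 := mul_nonpos_of_nonneg_of_nonpos hθ hN
    by_contra! hc
    have : 0 < ((N : ℤ) + 1) * cubeWeight (fun l => W (l + 1)) N := by positivity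
    linarith
  · refine Finset.sum_nonpos fun l _ => mul_nonpos_of_nonneg_of_nonpos (by positivity) ?_
    exact (h (l + 1)).2 (by push_cast; omega)

theorem SignChange.out_nonneg {θ : ℤ} {W : ℕ → ℤ} (h : SignChange θ W) {N : ℕ}
    (hN : 0 ≤ cubeWeight W (N + 1)) : 0 ≤ cubeWeight W N := by
  rcases le_or_gt θ (N + 1) with hθ | hθ
  · have h1 := cubeWeight_out_eq θ W N
    have h2 := h.moment_nonneg (N + 1)
    have h3 := mul_nonneg (sub_nonneg.2 hθ) hN
    by_contra! hc
    have : ((N : ℤ) + 1) * cubeWeight W N < 0 := mul_neg_of_pos_of_neg (by positivity) hc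
    linarith
  · refine Finset.sum_nonneg fun l hl => mul_nonneg (by positivity) ?_
    have := Finset.mem_range.1 hl
    exact (h l).1 (by omega)

theorem SignChange.in_neg {θ : ℤ} {W : ℕ → ℤ} (h : SignChange θ W) {N q : ℕ} (hθ : 0 ≤ θ)
    (hq : θ < q) (hqN : q ≤ N + 1) (hW : W q < 0)
    (hN : cubeWeight W (N + 1) ≤ 0) : cubeWeight (fun l => W (l + 1)) N < 0 := by
  have h1 := cubeWeight_in_eq θ W N
  have h2 := h.moment_pos hq hqN hW
  have h3 := mul_nonpos_of_nonneg_of_nonpos hθ hN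
  by_contra! hc
  have : 0 ≤ ((N : ℤ) + 1) * cubeWeight (fun l => W (l + 1)) N := by positivity
  linarith

theorem SignChange.in_neg_of_neg {θ : ℤ} {W : ℕ → ℤ} (h : SignChange θ W) {N : ℕ} (hθ : 0 < θ)
    (hN : cubeWeight W (N + 1) < 0) : cubeWeight (fun l => W (l + 1)) N < 0 := by
  have h1 := cubeWeight_in_eq θ W N
  have h2 := h.moment_nonneg (N + 1)
  have h3 := mul_neg_of_pos_of_neg hθ hN
  by_contra! hc
  have : 0 ≤ ((N : ℤ) + 1) * cubeWeight (fun l => W (l + 1)) N := by positivity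
  linarith

theorem SignChange.out_pos {θ : ℤ} {W : ℕ → ℤ} (h : SignChange θ W) {N q : ℕ}
    (hq : θ < q) (hqN : q ≤ N + 1) (hW : W q < 0)
    (hN : 0 ≤ cubeWeight W (N + 1)) : 0 < cubeWeight W N := by
  have h1 := cubeWeight_out_eq θ W N
  have h2 := h.moment_pos hq hqN hW
  have h3 := mul_nonneg (show 0 ≤ (N : ℤ) + 1 - θ by omega) hN
  by_contra! hc
  have : ((N : ℤ) + 1) * cubeWeight W N ≤ 0 :=
    mul_nonpos_of_nonneg_of_nonpos (by positivity) hc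
  linarith

theorem SignChange.in_le {θ : ℤ} {W : ℕ → ℤ} (h : SignChange θ W) (N : ℕ) :
    cubeWeight (fun l => W (l + 1)) N ≤ max 0 (cubeWeight W (N + 1)) := by
  rcases le_total (cubeWeight W (N + 1)) 0 with hN | hN
  · exact (h.in_nonpos hN).trans (le_max_left _ _)
  · have := h.out_nonneg hN
    have h2 := cubeWeight_succ W N
    exact le_max_of_le_right (by linarith)

theorem segWeight_le {θ : ℤ} {W : ℕ → ℤ} (h : SignChange θ W) (P : List Bool) :
    segWeight W P ≤ max 0 (cubeWeight W P.length) := by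
  induction P generalizing θ W with
  | nil => simp [segWeight, cubeWeight]
  | cons x P ih =>
    have h1 := h.in_le P.length
    have h2 := cubeWeight_succ W P.length
    rw [List.length_cons]
    cases x with
    | true =>
      exact (ih h.shift).trans (max_le (le_max_left _ _) h1)
    | false =>
      simp only [segWeight]
      have := ih h
      rcases le_max_iff.1 this with h3 | h3
      · linarith
      · exact le_max_of_le_right (by linarith)

theorem segWeight_of_count_eq_zero (W : ℕ → ℤ) (P : List Bool) (hP : P.count true = 0) :
    segWeight W P = cubeWeight W P.length := by
  induction P with
  | nil => simp [segWeight, cubeWeight]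
  | cons x P ih =>
    cases x with
    | true => simp at hP
    | false =>
      rw [List.length_cons, cubeWeight_succ, segWeight, ih (by simpa using hP)]

theorem segWeight_neg {θ : ℤ} {W : ℕ → ℤ} (h : SignChange θ W) (P : List Bool)
    (hP : (P.count true : ℤ) ≤ θ) (hneg : cubeWeight W P.length < 0) : segWeight W P < 0 := by
  induction P generalizing θ W with
  | nil => simpa [segWeight, cubeWeight] using hneg
  | cons x P ih =>
    rw [List.length_cons] at hneg
    cases x with
    | true =>
      simp only [List.count_cons_self, Nat.cast_add, Nat.cast_one] at hP
      exact ih h.shift (by linarith) (h.in_neg_of_neg (by omega) hneg)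
    | false =>
      rcases Nat.eq_zero_or_pos ((false :: P).count true) with h0 | h0
      · rw [segWeight_of_count_eq_zero W _ h0]
        exact hneg
      · have h1 := h.in_neg_of_neg (by omega) hneg
        have h2 := cubeWeight_succ W P.length
        simp only [segWeight]
        rcases le_max_iff.1 (segWeight_le h P) with h3 | h3 <;> linarith

theorem segWeight_lt {θ : ℤ} {W : ℕ → ℤ} (h : SignChange θ W) (P : List Bool) {q : ℕ}
    (hP : (P.count true : ℤ) ≤ θ) (hq : θ < q) (hW : W q < 0) (hm : MissesLevel q P) :
    segWeight W P < max 0 (cubeWeight W P.length) := by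
  induction P generalizing θ W q with
  | nil => exact hm.elim
  | cons x P ih =>
    have h1 := h.in_le P.length
    have h2 := cubeWeight_succ W P.length
    rw [List.length_cons]
    cases x with
    | true =>
      simp only [List.count_cons_self, Nat.cast_add, Nat.cast_one] at hP
      simp only [segWeight]
      rcases hm with hm | ⟨r, rfl, hm⟩
      · rcases lt_or_ge 0 (cubeWeight W (P.length + 1)) with h3 | h3
        · have h4 := h.out_pos hq (by omega) hW h3.le
          refine lt_max_of_lt_right ((segWeight_le h.shift P).trans_lt (max_lt h3 ?_))
          linarith
        · have h4 := h.in_neg (by omega) hq (by omega) hW h3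
          exact lt_max_of_lt_left (segWeight_neg h.shift P (by linarith) h4)
      · exact (ih h.shift (by linarith) (by push_cast at hq; linarith) hW hm).trans_le
          (max_le (le_max_left _ _) h1)
    | false =>
      simp only [segWeight]
      rcases lt_max_iff.1 (ih h (by simpa using hP) hq hW hm) with h3 | h3
      · linarith
      · exact lt_max_of_lt_right (by linarith)

/-- A sequence whose increments stay positive once they are nonnegative attains its maximum
over an interval only at the end points. -/
theorem lt_max_of_increment {b : ℕ → ℤ} {s : ℕ}
    (hb : ∀ a, a + 2 ≤ s → b a ≤ b (a + 1) → b (a + 1) < b (a + 2))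
    {a : ℕ} (ha : 0 < a) (has : a < s) : b a < max (b 0) (b s) := by
  obtain ⟨a, rfl⟩ : ∃ c, a = c + 1 := ⟨a - 1, by omega⟩
  rcases le_or_gt (b a) (b (a + 1)) with h | h
  · have up : ∀ d, a + 1 + d + 1 ≤ s →
        b (a + 1) < b (a + 1 + d + 1) ∧ b (a + 1 + d) ≤ b (a + 1 + d + 1) := by
      intro d
      induction d with
      | zero => exact fun hd => ⟨hb a (by omega) h, (hb a (by omega) h).le⟩
      | succ d ih =>
        intro hd
        have h1 := ih (by omega)
        have h2 := hb (a + 1 + d) (by omega) h1.2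
        exact ⟨h1.1.trans h2, h2.le⟩
    have := (up (s - a - 2) (by omega)).1
    rw [show a + 1 + (s - a - 2) + 1 = s by omega] at this
    exact lt_max_of_lt_right this
  · have down : ∀ d, d ≤ a → b (a + 1) < b (a - d) ∧ b (a - d + 1) < b (a - d) := by
      intro d
      induction d with
      | zero => exact fun _ => ⟨h, h⟩
      | succ d ih =>
        intro hd
        have h1 := ih (by omega)
        have h2 : b (a - (d + 1) + 1) < b (a - (d + 1)) := by
          by_contra! hc
          have h3 := hb (a - (d + 1)) (by omega) hc
          rw [show a - (d + 1) + 1 = a - d by omega,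
            show a - (d + 1) + 2 = a - d + 1 by omega] at h3
          exact absurd h1.2 (by linarith)
        refine ⟨?_, h2⟩
        rw [show a - (d + 1) + 1 = a - d by omega] at h2
        exact h1.1.trans h2
    have := (down a le_rfl).1
    rw [Nat.sub_self] at this
    exact lt_max_of_lt_left this

theorem segWeight_replicate_append (W : ℕ → ℤ) (i : ℕ) (P : List Bool) :
    segWeight W (List.replicate i true ++ P) = segWeight (fun l => W (l + i)) P := by
  induction i generalizing W with
  | zero => simp
  | succ i ih =>
    rw [List.replicate_succ, List.cons_append, segWeight, ih]
    congr 1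

/-- An initial segment that properly contains the subcube above the first `s` coordinates
and misses part of level `q` weighs less than that subcube or less than the whole cube. -/
theorem segWeight_lt_max_subcube {θ : ℤ} {W : ℕ → ℤ} (h : SignChange θ W) {N s i q : ℕ}
    (Q : List Bool) (hi : i < s) (hlen : i + 1 + Q.length = N)
    (hcount : ((i + Q.count true : ℕ) : ℤ) ≤ θ) (hsθ : (s : ℤ) ≤ θ) (hq : θ < q)
    (hqN : q + 1 ≤ N) (hW : W q < 0)
    (hm : MissesLevel q (List.replicate i true ++ false :: Q)) :
    segWeight W (List.replicate i true ++ false :: Q) <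
      max (cubeWeight (fun l => W (l + s)) (N - s)) (cubeWeight W N) := by
  set b : ℕ → ℤ := fun a => cubeWeight (fun l => W (l + a)) (N - a) with hbdef
  set c : ℕ → ℤ := fun a => cubeWeight (fun l => W (l + a)) (N - a - 1) with hcdef
  have hshift : ∀ a, (fun l => W (l + (a + 1))) = fun l => (fun m => W (m + a)) (l + 1) := by
    intro a; funext l; congr 1; omega
  have hbc : ∀ a, a < N → b a = b (a + 1) + c a := by
    intro a ha
    simp only [hbdef, hcdef]
    rw [show N - a = N - a - 1 + 1 by omega, cubeWeight_succ, hshift a,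
      show N - (a + 1) = N - a - 1 by omega]
    rfl
  have hb : ∀ a, a + 2 ≤ s → b a ≤ b (a + 1) → b (a + 1) < b (a + 2) := by
    intro a ha hle
    have h1 := hbc a (by omega)
    have h2 := hbc (a + 1) (by omega)
    have h3 : c a ≤ 0 := by linarith
    have h4 : c (a + 1) < 0 := by
      have hs := h.shift_add a
      simp only [hcdef] at h3 ⊢
      rw [hshift a]
      rw [show N - a - 1 = N - (a + 1) - 1 + 1 by omega] at h3
      exact hs.in_neg (q := q - a) (by omega) (by omega) (by omega)
        (by simpa [show q - a + a = q by omega] using hW) h3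
    linarith
  have hend : ∀ a, 0 < a → a < s → b a < max (b s) (b 0) := fun a h0 h1 =>
    max_comm (b 0) (b s) ▸ lt_max_of_increment hb h0 h1
  have hend' : ∀ a, a ≤ s → b a ≤ max (b s) (b 0) := by
    intro a ha
    rcases Nat.eq_zero_or_pos a with rfl | h0
    · exact le_max_right _ _
    rcases ha.eq_or_lt with rfl | h1
    · exact le_max_left _ _
    · exact (hend a h0 h1).le
  have hgoal : segWeight W (List.replicate i true ++ false :: Q)
      = b (i + 1) + segWeight (fun l => W (l + i)) Q := by
    rw [segWeight_replicate_append, segWeight]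
    congr 1
    simp only [hbdef]
    rw [hshift i, show N - (i + 1) = Q.length by omega]
  have hQ : Q.length = N - i - 1 := by omega
  change _ < max (b s) (b 0)
  rw [hgoal]
  have hbi := hbc i (by omega)
  have hs := h.shift_add i
  rcases Nat.eq_zero_or_pos i with rfl | hi0
  · have h1 := segWeight_lt h Q (q := q) (by simpa using hcount) hq hW hm
    have h2 : c 0 = cubeWeight W Q.length := by simp [hcdef, hQ]
    rw [← h2] at h1
    simp only [Nat.add_zero]
    rcases lt_max_iff.1 h1 with h3 | h3
    · exact lt_of_lt_of_le (by linarith) (hend' (0 + 1) (by omega))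
    · exact lt_of_lt_of_le (by linarith) (hend' 0 (by omega))
  · have hci : c i = cubeWeight (fun l => W (l + i)) Q.length := by simp only [hcdef, hQ]
    rcases lt_or_ge (c i) 0 with h3 | h3
    · have h4 := segWeight_neg hs Q (by push_cast at hcount; linarith) (hci ▸ h3)
      exact lt_of_lt_of_le (by linarith) (hend' (i + 1) (by omega))
    · have h4 := segWeight_le hs Q
      rw [← hci, max_eq_right h3] at h4
      exact lt_of_le_of_lt (by linarith) (hend i hi0 hi)

/-- The set `A` equals `B` or contains the first element above `c` where they differ. -/
def LexAbove (c : ℕ) (A B : Finset ℕ) : Prop :=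
  (∀ y, c < y → (y ∈ A ↔ y ∈ B)) ∨
    ∃ x, c < x ∧ x ∈ A ∧ x ∉ B ∧ ∀ y, c < y → y < x → (y ∈ A ↔ y ∈ B)

theorem lex_iff {A B : Finset ℕ} :
    lex A B ↔ A = B ∨ ∃ x, x ∈ A ∧ x ∉ B ∧ ∀ y < x, (y ∈ A ↔ y ∈ B) := by
  constructor
  · intro h
    by_cases hAB : A = B
    · exact Or.inl hAB
    refine Or.inr ?_
    have hne : (A \ B).Nonempty := by
      rw [Finset.sdiff_nonempty]
      intro hsub
      rcases h with h | h
      · exact hAB (hsub.antisymm h)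
      · rw [Finset.sdiff_eq_empty_iff_subset.2 hsub, Finset.min_empty] at h
        exact not_top_lt h
    have hx := Finset.min'_mem _ hne
    rw [Finset.mem_sdiff] at hx
    refine ⟨(A \ B).min' hne, hx.1, hx.2, fun y hy => ⟨fun hyA => ?_, fun hyB => ?_⟩⟩
    · by_contra hyB
      exact absurd (Finset.min'_le _ y (Finset.mem_sdiff.2 ⟨hyA, hyB⟩)) (not_le.2 hy)
    · by_contra hyA
      rcases h with h | h
      · exact hyA (h hyB)
      · have h1 := h.trans_le (Finset.min_le (Finset.mem_sdiff.2 ⟨hyB, hyA⟩))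
        rw [← Finset.coe_min' hne] at h1
        exact absurd (WithTop.coe_lt_coe.1 h1) (not_lt.2 hy.le)
  · rintro (rfl | ⟨x, hxA, hxB, hx⟩)
    · exact Or.inl subset_rfl
    · refine Or.inr ((Finset.min_le (Finset.mem_sdiff.2 ⟨hxA, hxB⟩)).trans_lt ?_)
      rcases (B \ A).eq_empty_or_nonempty with h0 | hne
      · rw [h0, Finset.min_empty]
        exact WithTop.coe_lt_top x
      · rw [← Finset.coe_min' hne, WithTop.coe_lt_coe]
        have hm := Finset.mem_sdiff.1 (Finset.min'_mem _ hne)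
        by_contra! hle
        rcases hle.lt_or_eq with h1 | h1
        · exact hm.2 ((hx _ h1).2 hm.1)
        · exact hm.2 (by rw [h1]; exact hxA)

theorem lex_refl (A : Finset ℕ) : lex A A := Or.inl subset_rfl

theorem lex_total (A B : Finset ℕ) : lex A B ∨ lex B A := by
  by_cases hAB : A = B
  · exact Or.inl (hAB ▸ lex_refl A)
  have hne : (symmDiff A B).Nonempty := by
    rw [Finset.nonempty_iff_ne_empty]
    intro h
    exact hAB (symmDiff_eq_bot.1 h)
  have hx := Finset.min'_mem _ hne
  have hlt : ∀ y < (symmDiff A B).min' hne, (y ∈ A ↔ y ∈ B) := by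
    intro y hy
    by_contra hc
    refine absurd (Finset.min'_le _ y ?_) (not_le.2 hy)
    rw [Finset.mem_symmDiff]
    tauto
  rcases Finset.mem_symmDiff.1 hx with h | h
  · exact Or.inl (lex_iff.2 (Or.inr ⟨_, h.1, h.2, hlt⟩))
  · exact Or.inr (lex_iff.2 (Or.inr ⟨_, h.1, h.2, fun y hy => (hlt y hy).symm⟩))

theorem lex_trans {A B C : Finset ℕ} (h1 : lex A B) (h2 : lex B C) : lex A C := by
  rw [lex_iff] at *
  rcases h1 with rfl | ⟨x, hxA, hxB, hx⟩
  · exact h2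
  rcases h2 with rfl | ⟨z, hzB, hzC, hz⟩
  · exact Or.inr ⟨x, hxA, hxB, hx⟩
  rcases lt_trichotomy x z with h | rfl | h
  · exact Or.inr ⟨x, hxA, fun hC => hxB ((hz x h).2 hC),
      fun y hy => (hx y hy).trans (hz y (hy.trans h))⟩
  · exact absurd hzB hxB
  · exact Or.inr ⟨z, (hx z h).2 hzB, hzC, fun y hy => (hx y (hy.trans h)).trans (hz y hy)⟩

theorem lex_antisymm {A B : Finset ℕ} (h1 : lex A B) (h2 : lex B A) : A = B := by
  rw [lex_iff] at *
  rcases h1 with rfl | ⟨x, hxA, hxB, hx⟩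
  · rfl
  rcases h2 with rfl | ⟨z, hzB, hzA, hz⟩
  · rfl
  rcases lt_trichotomy x z with h | rfl | h
  · exact absurd ((hz x h).2 hxA) hxB
  · exact absurd hzB hxB
  · exact absurd ((hx z h).2 hzB) hzA

theorem lexAbove_zero_iff {n : ℕ} {A B : Finset ℕ} (hA : A ⊆ ground n) (hB : B ⊆ ground n) :
    LexAbove 0 A B ↔ lex A B := by
  have hA0 : 0 ∉ A := fun h => by simpa [ground] using hA h
  have hB0 : 0 ∉ B := fun h => by simpa [ground] using hB h
  rw [lex_iff]
  refine or_congr ⟨fun h => ?_, fun h y _ => by rw [h]⟩ ⟨?_, ?_⟩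
  · ext y
    rcases Nat.eq_zero_or_pos y with rfl | hy
    · simp [hA0, hB0]
    · exact h y hy
  · rintro ⟨x, _, hxA, hxB, hx⟩
    refine ⟨x, hxA, hxB, fun y hy => ?_⟩
    rcases Nat.eq_zero_or_pos y with rfl | hy0
    · simp [hA0, hB0]
    · exact hx y hy0 hy
  · rintro ⟨x, hxA, hxB, hx⟩
    exact ⟨x, Nat.pos_of_ne_zero fun h => hA0 (h ▸ hxA), hxA, hxB, fun y _ hy => hx y hy⟩

theorem lexAbove_succ_of_iff {c : ℕ} {A B : Finset ℕ} (h : c + 1 ∈ A ↔ c + 1 ∈ B) :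
    LexAbove c A B ↔ LexAbove (c + 1) A B := by
  refine or_congr ⟨fun h1 y hy => h1 y (by omega), fun h1 y hy => ?_⟩ ⟨?_, ?_⟩
  · rcases eq_or_lt_of_le (Nat.succ_le_of_lt hy) with rfl | hy
    · exact h
    · exact h1 y hy
  · rintro ⟨x, hcx, hxA, hxB, hx⟩
    have : x ≠ c + 1 := by rintro rfl; exact hxB (h.1 hxA)
    exact ⟨x, by omega, hxA, hxB, fun y hy hyx => hx y (by omega) hyx⟩
  · rintro ⟨x, hcx, hxA, hxB, hx⟩
    refine ⟨x, by omega, hxA, hxB, fun y hy hyx => ?_⟩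
    rcases eq_or_lt_of_le (Nat.succ_le_of_lt hy) with rfl | hy
    · exact h
    · exact hx y hy hyx

theorem lexAbove_of_mem_of_notMem {c : ℕ} {A B : Finset ℕ} (hA : c + 1 ∈ A) (hB : c + 1 ∉ B) :
    LexAbove c A B :=
  Or.inr ⟨c + 1, by omega, hA, hB, fun y _ _ => by omega⟩

theorem not_lexAbove_of_notMem_of_mem {c : ℕ} {A B : Finset ℕ} (hA : c + 1 ∉ A)
    (hB : c + 1 ∈ B) : ¬ LexAbove c A B := by
  rintro (h | ⟨x, hcx, hxA, hxB, hx⟩)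
  · exact hA ((h (c + 1) (by omega)).2 hB)
  · rcases eq_or_lt_of_le (Nat.succ_le_of_lt hcx) with rfl | hcx
    · exact hA hxA
    · exact hA ((hx (c + 1) (by omega) hcx).2 hB)

theorem lexAbove_congr_left {c : ℕ} {A A' B : Finset ℕ} (h : ∀ y, c < y → (y ∈ A ↔ y ∈ A')) :
    LexAbove c A B ↔ LexAbove c A' B := by
  refine or_congr (forall₂_congr fun y hy => by rw [h y hy]) (exists_congr fun x =>
    and_congr_right fun hx => ?_)
  rw [h x hx]
  refine and_congr_right fun _ => and_congr_right fun _ =>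
    forall₂_congr fun y hy => by rw [h y hy]

/-- The indicator list of `R` on `c + 1, …, c + N`. -/
def indicatorList (R : Finset ℕ) (c : ℕ) : ℕ → List Bool
  | 0 => []
  | N + 1 => decide (c + 1 ∈ R) :: indicatorList R (c + 1) N

theorem indicatorList_length (R : Finset ℕ) (c N : ℕ) : (indicatorList R c N).length = N := by
  induction N generalizing c with
  | zero => rfl
  | succ N ih => simp [indicatorList, ih]

theorem indicatorList_count_le (R : Finset ℕ) (c N : ℕ) :
    (indicatorList R c N).count true ≤ #(R.filter (c < ·)) := by
  induction N generalizing c with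
  | zero => simp [indicatorList]
  | succ N ih =>
    by_cases h : c + 1 ∈ R
    · have : R.filter (c < ·) = insert (c + 1) (R.filter (c + 1 < ·)) := by
        ext y
        simp only [Finset.mem_filter, Finset.mem_insert]
        constructor
        · rintro ⟨h1, h2⟩
          by_cases hy : y = c + 1
          · exact Or.inl hy
          · exact Or.inr ⟨h1, by omega⟩
        · rintro (rfl | ⟨h1, h2⟩)
          · exact ⟨h, by omega⟩
          · exact ⟨h1, by omega⟩
      rw [this, Finset.card_insert_of_notMem (by simp)]
      simpa [indicatorList, h] using ih (c + 1)
    · simp only [indicatorList, h, decide_false]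
      rw [List.count_cons_of_ne (by simp)]
      refine (ih (c + 1)).trans (Finset.card_le_card fun y => ?_)
      simp only [Finset.mem_filter]
      exact fun hy => ⟨hy.1, by omega⟩

theorem indicatorList_eq_replicate_append {R : Finset ℕ} (i N : ℕ) {c : ℕ}
    (h : ∀ y, c < y → y ≤ c + i → y ∈ R) :
    indicatorList R c (i + N) = List.replicate i true ++ indicatorList R (c + i) N := by
  induction i generalizing c with
  | zero => simp
  | succ i ih =>
    rw [show i + 1 + N = i + N + 1 by omega, indicatorList, List.replicate_succ,
      List.cons_append, ih fun y h1 h2 => h y (by omega) (by omega)]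
    simp [h (c + 1) (by omega) (by omega), show c + 1 + i = c + (i + 1) by omega]

theorem missesLevel_indicatorList {R X : Finset ℕ} {c N : ℕ} (hX : X ⊆ Icc (c + 1) (c + N))
    (hR : ∀ r ∈ R, r ≤ c + N) (hlex : ¬ LexAbove c X R) :
    MissesLevel #X (indicatorList R c N) := by
  induction N generalizing c X with
  | zero =>
    refine absurd (Or.inl fun y hy => ⟨fun h => ?_, fun h => ?_⟩) hlex
    · have := Finset.mem_Icc.1 (hX h); omega
    · have := hR y h; omega
  | succ N ih =>
    have hR' : ∀ r ∈ R, r ≤ c + 1 + N := fun r hr => by have := hR r hr; omega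
    by_cases hcR : c + 1 ∈ R
    · simp only [indicatorList, hcR, decide_true]
      by_cases hcX : c + 1 ∈ X
      · refine Or.inr ⟨#(X.erase (c + 1)), (Finset.card_erase_add_one hcX).symm, ih ?_ hR' ?_⟩
        · intro y hy
          have h1 := Finset.mem_erase.1 hy
          have h2 := Finset.mem_Icc.1 (hX h1.2)
          exact Finset.mem_Icc.2 ⟨by omega, by omega⟩
        · rw [lexAbove_congr_left (A' := X) fun y hy => by
            simp only [Finset.mem_erase]; exact and_iff_right (by omega)]
          rwa [lexAbove_succ_of_iff (iff_of_true hcX hcR)] at hlex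
      · refine Or.inl ?_
        rw [indicatorList_length]
        have : X ⊆ Icc (c + 2) (c + (N + 1)) := by
          intro y hy
          have h2 := Finset.mem_Icc.1 (hX hy)
          have : y ≠ c + 1 := by rintro rfl; exact hcX hy
          exact Finset.mem_Icc.2 ⟨by omega, by omega⟩
        have := Finset.card_le_card this
        rw [Nat.card_Icc] at this
        omega
    · simp only [indicatorList, hcR, decide_false]
      have hcX : c + 1 ∉ X := fun h => hlex (lexAbove_of_mem_of_notMem h hcR)
      refine ih ?_ hR' ?_
      · intro y hy
        have h2 := Finset.mem_Icc.1 (hX hy)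
        have : y ≠ c + 1 := by rintro rfl; exact hcX hy
        exact Finset.mem_Icc.2 ⟨by omega, by omega⟩
      · rwa [lexAbove_succ_of_iff (iff_of_false hcX hcR)] at hlex

theorem sum_powerset_weight (W : ℕ → ℤ) (A : Finset ℕ) :
    ∑ X ∈ A.powerset, W #X = cubeWeight W #A := by
  rw [Finset.sum_powerset_apply_card]
  simp [cubeWeight]

theorem sum_lexAbove_weight (W : ℕ → ℤ) {R : Finset ℕ} {c N : ℕ} (hR : ∀ r ∈ R, r ≤ c + N) :
    ∑ X ∈ (Icc (c + 1) (c + N)).powerset with LexAbove c X R, W #X =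
      segWeight W (indicatorList R c N) := by
  induction N generalizing c W with
  | zero =>
    have : LexAbove c ∅ R := Or.inl fun y hy => ⟨by simp, fun h => by have := hR y h; omega⟩
    simp [Finset.filter_singleton, this, indicatorList, segWeight]
  | succ N ih =>
    have hR' : ∀ r ∈ R, r ≤ c + 1 + N := fun r hr => by have := hR r hr; omega
    have hins : Icc (c + 1) (c + (N + 1)) = insert (c + 1) (Icc (c + 1 + 1) (c + 1 + N)) := by
      ext y; simp only [Finset.mem_Icc, Finset.mem_insert]; omega
    have hnot : ∀ X ∈ (Icc (c + 1 + 1) (c + 1 + N)).powerset, c + 1 ∉ X := by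
      intro X hX h
      have := Finset.mem_Icc.1 (Finset.mem_powerset.1 hX h)
      omega
    have hmem : ∀ X : Finset ℕ, ∀ y, c + 1 < y → (y ∈ insert (c + 1) X ↔ y ∈ X) := by
      intro X y hy
      simp only [Finset.mem_insert]
      exact or_iff_right (by omega)
    rw [hins, Finset.sum_filter, Finset.sum_powerset_insert (by simp)]
    by_cases hcR : c + 1 ∈ R
    · simp only [indicatorList, hcR, decide_true, segWeight]
      rw [← ih _ hR', Finset.sum_filter, Finset.sum_eq_zero, zero_add]
      · refine Finset.sum_congr rfl fun X hX => ?_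
        rw [Finset.card_insert_of_notMem (hnot X hX),
          lexAbove_succ_of_iff (iff_of_true (Finset.mem_insert_self _ _) hcR),
          lexAbove_congr_left (hmem X)]
      · exact fun X hX => if_neg (not_lexAbove_of_notMem_of_mem (hnot X hX) hcR)
    · simp only [indicatorList, hcR, decide_false, segWeight]
      rw [← ih _ hR', Finset.sum_filter, add_comm, indicatorList_length]
      congr 1
      · rw [show N = #(Icc (c + 1 + 1) (c + 1 + N)) by rw [Nat.card_Icc]; omega,
          ← sum_powerset_weight]
        rw [← show N = #(Icc (c + 1 + 1) (c + 1 + N)) by rw [Nat.card_Icc]; omega]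
        refine Finset.sum_congr rfl fun X hX => ?_
        rw [Finset.card_insert_of_notMem (hnot X hX),
          if_pos (lexAbove_of_mem_of_notMem (Finset.mem_insert_self _ _) hcR)]
      · refine Finset.sum_congr rfl fun X hX => ?_
        rw [lexAbove_succ_of_iff (iff_of_false (hnot X hX) hcR)]

/-- The weight function counting the families indexed by `J` positively, and the levels
`p` and `q` negatively. -/
def systemWeight {ι : Type*} (J : Finset ι) (k : ι → ℕ) (p q l : ℕ) : ℤ :=
  (∑ j ∈ J, if k j = l then 1 else 0) - (if p = l then 1 else 0) - if q = l then 1 else 0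

theorem card_Lset_eq_sum (n l : ℕ) (R : Finset ℕ) :
    (#(Lset n R l) : ℤ) =
      ∑ X ∈ (ground n).powerset with lex X R, if l = #X then 1 else 0 := by
  rw [Finset.sum_boole, Finset.filter_filter]
  congr 2
  ext X
  simp only [Lset, ksubsets, Finset.mem_filter, Finset.mem_powersetCard, Finset.mem_powerset]
  tauto

theorem segWeight_systemWeight {ι : Type*} (J : Finset ι) (k : ι → ℕ) (p q n : ℕ)
    {R : Finset ℕ} (hR : R ⊆ ground n) :
    segWeight (systemWeight J k p q) (indicatorList R 0 n) =
      (∑ j ∈ J, (#(Lset n R (k j)) : ℤ)) - #(Lset n R p) - #(Lset n R q) := by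
  have hR' : ∀ r ∈ R, r ≤ 0 + n := fun r hr => by
    have := Finset.mem_Icc.1 (hR hr); omega
  rw [← sum_lexAbove_weight _ hR']
  have hf : ((Icc (0 + 1) (0 + n)).powerset.filter fun X => LexAbove 0 X R) =
      (ground n).powerset.filter fun X => lex X R := by
    rw [zero_add, zero_add]
    refine Finset.filter_congr fun X hX => lexAbove_zero_iff (Finset.mem_powerset.1 hX) hR
  rw [hf]
  simp only [systemWeight, Finset.sum_sub_distrib, card_Lset_eq_sum]
  rw [Finset.sum_comm]

theorem cubeWeight_indicator {m s : ℕ} (N : ℕ) (h : s ≤ m) :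
    cubeWeight (fun l => if m = l + s then 1 else 0) N = N.choose (m - s) := by
  simp only [cubeWeight, mul_ite, mul_one, mul_zero]
  have : ∀ l, (m = l + s) ↔ (m - s = l) := fun l => by omega
  simp only [this, Finset.sum_ite_eq, Finset.mem_range]
  split_ifs with h1
  · rfl
  · rw [Nat.choose_eq_zero_of_lt (by omega)]; rfl

theorem cubeWeight_systemWeight {ι : Type*} (J : Finset ι) (k : ι → ℕ) {p q s : ℕ} (N : ℕ)
    (hk : ∀ j ∈ J, s ≤ k j) (hp : s ≤ p) (hq : s ≤ q) :
    cubeWeight (fun l => systemWeight J k p q (l + s)) N =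
      (∑ j ∈ J, (N.choose (k j - s) : ℤ)) - N.choose (p - s) - N.choose (q - s) := by
  rw [← cubeWeight_indicator N hp, ← cubeWeight_indicator N hq,
    ← Finset.sum_congr rfl fun j hj => cubeWeight_indicator N (hk j hj)]
  simp only [cubeWeight, systemWeight]
  rw [Finset.sum_comm, ← Finset.sum_sub_distrib, ← Finset.sum_sub_distrib]
  refine Finset.sum_congr rfl fun l _ => ?_
  rw [← Finset.mul_sum]
  ring

theorem signChange_systemWeight {ι : Type*} (J : Finset ι) (k : ι → ℕ) {p q : ℕ}
    (hk : ∀ j ∈ J, k j ≤ p) (hpq : p < q) : SignChange p (systemWeight J k p q) := by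
  intro l
  constructor
  · intro hl
    have h1 : p ≠ l := by omega
    have h2 : q ≠ l := by omega
    simp [systemWeight, h1, h2]
  · intro hl
    have h1 : p ≠ l := by omega
    have h3 : ∑ j ∈ J, (if k j = l then (1 : ℤ) else 0) = 0 :=
      Finset.sum_eq_zero fun j hj => if_neg (by have := hk j hj; omega)
    simp only [systemWeight, h3, if_neg h1]
    split_ifs <;> simp

theorem systemWeight_neg {ι : Type*} (J : Finset ι) (k : ι → ℕ) {p q : ℕ}
    (hk : ∀ j ∈ J, k j ≤ p) (hpq : p < q) : systemWeight J k p q q < 0 := by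
  have h3 : ∑ j ∈ J, (if k j = q then (1 : ℤ) else 0) = 0 :=
    Finset.sum_eq_zero fun j hj => if_neg (by have := hk j hj; omega)
  simp [systemWeight, h3, hpq.ne]

theorem mem_ksubsets {n k : ℕ} {A : Finset ℕ} : A ∈ ksubsets n k ↔ A ⊆ ground n ∧ #A = k :=
  Finset.mem_powersetCard

theorem card_ground (n : ℕ) : #(ground n) = n := by simp [ground]

/-- The `a`-sets whose complement does not precede `R`. -/
def coInitial (n a : ℕ) (R : Finset ℕ) : Finset (Finset ℕ) :=
  (ksubsets n a).filter fun A => ¬ lex (ground n \ A) R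

theorem card_coInitial (n a : ℕ) (R : Finset ℕ) (ha : a ≤ n) :
    #(coInitial n a R) + #(Lset n R (n - a)) = n.choose a := by
  have h1 : #(Lset n R (n - a)) = #((ksubsets n a).filter fun A => lex (ground n \ A) R) := by
    refine Finset.card_nbij' (fun X => ground n \ X) (fun X => ground n \ X) ?_ ?_ ?_ ?_
    · intro X hX
      simp only [Lset, Finset.coe_filter, Set.mem_ofPred_eq, mem_ksubsets] at hX ⊢
      refine ⟨⟨Finset.sdiff_subset, ?_⟩, ?_⟩
      · rw [Finset.card_sdiff_of_subset hX.1.1, card_ground, hX.1.2]; omega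
      · rw [Finset.sdiff_sdiff_eq_self hX.1.1]; exact hX.2
    · intro X hX
      simp only [Lset, Finset.coe_filter, Set.mem_ofPred_eq, mem_ksubsets] at hX ⊢
      refine ⟨⟨Finset.sdiff_subset, ?_⟩, hX.2⟩
      rw [Finset.card_sdiff_of_subset hX.1.1, card_ground, hX.1.2]
    · intro X hX
      simp only [Lset, Finset.coe_filter, Set.mem_ofPred_eq, mem_ksubsets] at hX
      exact Finset.sdiff_sdiff_eq_self hX.1.1
    · intro X hX
      simp only [Finset.coe_filter, Set.mem_ofPred_eq, mem_ksubsets] at hX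
      exact Finset.sdiff_sdiff_eq_self hX.1.1
  rw [h1, add_comm, coInitial, Finset.card_filter_add_card_filter_not, ksubsets,
    Finset.card_powersetCard, card_ground]

theorem not_lex_compl_of_cross {n a b : ℕ} {A R : Finset ℕ} (hA : A ∈ ksubsets n a)
    (hR : R ∈ ksubsets n b) (hab : a + b ≤ n)
    (hcross : ∀ B ∈ Lset n R b, (A ∩ B).Nonempty) : ¬ lex (ground n \ A) R := by
  rw [mem_ksubsets] at hA hR
  have hcard : #(ground n \ A) = n - a := by
    rw [Finset.card_sdiff_of_subset hA.1, card_ground, hA.2]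
  have hcontra : ∀ B ∈ Lset n R b, ¬ B ⊆ ground n \ A := by
    intro B hB hsub
    obtain ⟨x, hx⟩ := hcross B hB
    rw [Finset.mem_inter] at hx
    exact (Finset.mem_sdiff.1 (hsub hx.2)).2 hx.1
  intro hlex
  by_cases hRA : R ⊆ ground n \ A
  · exact hcontra R (Finset.mem_filter.2 ⟨mem_ksubsets.2 hR, lex_refl R⟩) hRA
  rcases lex_iff.1 hlex with h | ⟨x, hxA, hxR, hx⟩
  · exact hRA h.ge
  have hPR : R.filter (· < x) ⊂ R := by
    refine Finset.filter_ssubset.2 ?_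
    by_contra! hall
    exact hRA fun y hy => (hx y (hall y hy)).2 hy
  have hsub : insert x (R.filter (· < x)) ⊆ ground n \ A := by
    intro y hy
    rcases Finset.mem_insert.1 hy with rfl | hy
    · exact hxA
    · have := Finset.mem_filter.1 hy
      exact (hx y this.2).2 this.1
  have hle : #(insert x (R.filter (· < x))) ≤ b := by
    have h1 := Finset.card_insert_le x (R.filter (· < x))
    have h2 := Finset.card_lt_card hPR
    omega
  obtain ⟨B, hB1, hB2, hB3⟩ := Finset.exists_subsuperset_card_eq hsub hle (by omega)
  refine hcontra B (Finset.mem_filter.2 ⟨mem_ksubsets.2 ⟨hB2.trans Finset.sdiff_subset, hB3⟩,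
    lex_iff.2 (Or.inr ⟨x, hB1 (Finset.mem_insert_self _ _), hxR, fun y hy => ⟨fun h => ?_,
      fun h => ?_⟩⟩)⟩) hB2
  · exact (hx y hy).1 (hB2 h)
  · exact hB1 (Finset.mem_insert_of_mem (Finset.mem_filter.2 ⟨h, hy⟩))

theorem card_insert_tail {n k c : ℕ} (hk : 2 ≤ k) (hkn : k ≤ n) (hc : c + k ≤ n + 1) :
    #(insert c (Icc (n - k + 2) n)) = k := by
  rw [Finset.card_insert_of_notMem (by rw [Finset.mem_Icc]; omega), Nat.card_Icc]
  omega

/-- `{1, n - k + 2, …, n}` is the last `k`-set containing `1`. -/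
theorem eq_of_last_star_lex {n k : ℕ} {A : Finset ℕ} (hk : 2 ≤ k) (hkn : k ≤ n)
    (hA : A ∈ ksubsets n k) (h1 : 1 ∈ A) (h : lex (insert 1 (Icc (n - k + 2) n)) A) :
    insert 1 (Icc (n - k + 2) n) = A := by
  rw [mem_ksubsets] at hA
  rcases lex_iff.1 h with h | ⟨x, hxD, hxA, hx⟩
  · exact h
  symm
  refine Finset.eq_of_subset_of_card_le (fun y hy => ?_)
    (by rw [card_insert_tail hk hkn (by omega), hA.2])
  rcases lt_trichotomy y x with hyx | rfl | hyx
  · exact (hx y hyx).2 hy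
  · exact absurd hy hxA
  · have h2 := Finset.mem_Icc.1 (hA.1 hy)
    rcases Finset.mem_insert.1 hxD with rfl | hxD
    · exact absurd h1 hxA
    · have h3 := Finset.mem_Icc.1 hxD
      exact Finset.mem_insert_of_mem (Finset.mem_Icc.2 ⟨by omega, h2.2⟩)

theorem lex_last_star {n k : ℕ} {A : Finset ℕ} (hk : 2 ≤ k) (hkn : k ≤ n)
    (hA : A ∈ ksubsets n k) (h1 : 1 ∈ A) : lex A (insert 1 (Icc (n - k + 2) n)) := by
  rcases lex_total A (insert 1 (Icc (n - k + 2) n)) with h | h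
  · exact h
  · rw [eq_of_last_star_lex hk hkn hA h1 h]
    exact lex_refl A

theorem Icc_lex {n s : ℕ} {B : Finset ℕ} (hB : B ∈ ksubsets n s) : lex (Icc 1 s) B := by
  rw [mem_ksubsets] at hB
  rcases lex_total (Icc 1 s) B with h | h
  · exact h
  rcases lex_iff.1 h with rfl | ⟨x, hxB, hxs, hx⟩
  · exact lex_refl _
  have hx1 := Finset.mem_Icc.1 (hB.1 hxB)
  rw [Finset.mem_Icc] at hxs
  have hsub : Icc 1 s ⊆ B := fun y hy =>
    (hx y (by have := Finset.mem_Icc.1 hy; omega)).2 hy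
  rw [Finset.eq_of_subset_of_card_le hsub (by simp [hB.2])]
  exact lex_refl _

theorem exists_lex_last {ι : Type*} {J : Finset ι} (hJ : J.Nonempty) (I : ι → Finset ℕ) :
    ∃ j₀ ∈ J, ∀ j ∈ J, lex (I j) (I j₀) := by
  induction hJ using Finset.Nonempty.cons_induction with
  | singleton a => exact ⟨a, by simp, by simp [lex_refl]⟩
  | cons a J ha hJ ih =>
    obtain ⟨j₀, hj₀, h⟩ := ih
    rcases lex_total (I a) (I j₀) with h1 | h1
    · refine ⟨j₀, Finset.mem_cons_of_mem hj₀, fun j hj => ?_⟩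
      rcases Finset.mem_cons.1 hj with rfl | hj
      · exact h1
      · exact h j hj
    · refine ⟨a, Finset.mem_cons_self a J, fun j hj => ?_⟩
      rcases Finset.mem_cons.1 hj with rfl | hj
      · exact lex_refl _
      · exact lex_trans (h j hj) h1

/-- An initial segment that ends at a set `R` containing `1`, properly extends the subcube of
supersets of `[s]`, and misses a `q`-set containing `1`, weighs less than that subcube or
less than the star of `1`. -/
theorem segWeight_lt_of_interior {θ : ℤ} {W : ℕ → ℤ} (h : SignChange θ W) {n s q : ℕ}
    {R X : Finset ℕ} (hR : R ⊆ ground n) (h1R : 1 ∈ R) (hRθ : (#R : ℤ) ≤ θ)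
    (hlex : lex (Icc 1 s) R) (hne : R ≠ Icc 1 s) (hsθ : (s : ℤ) ≤ θ) (hq : θ < q)
    (hqn : q < n) (hW : W q < 0)
    (hX : X ∈ ksubsets n q) (h1X : 1 ∈ X) (hXR : ¬ lex X R) :
    segWeight W (indicatorList R 0 n) <
      max (cubeWeight (fun l => W (l + s)) (n - s))
        (cubeWeight (fun l => W (l + 1)) (n - 1)) := by
  have hsub : ¬ Icc 1 s ⊆ R := by
    intro hsub
    exact hne (lex_antisymm (Or.inl hsub) hlex)
  have hex : ∃ m, m + 1 ≤ s ∧ m + 1 ∉ R := by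
    obtain ⟨y, hy, hyR⟩ := Finset.not_subset.1 hsub
    have := Finset.mem_Icc.1 hy
    exact ⟨y - 1, by omega, by rwa [show y - 1 + 1 = y by omega]⟩
  obtain ⟨hms, hmR⟩ := Nat.find_spec hex
  have hmin : ∀ y, 0 < y → y ≤ Nat.find hex → y ∈ R := by
    intro y hy0 hy
    by_contra hyR
    exact Nat.find_min hex (m := y - 1) (by omega)
      ⟨by omega, by rwa [show y - 1 + 1 = y by omega]⟩
  generalize Nat.find hex = m at hms hmR hmin
  obtain ⟨i, rfl⟩ : ∃ i, m = i + 1 :=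
    ⟨m - 1, by have : m ≠ 0 := by rintro rfl; exact hmR h1R
               omega⟩
  obtain ⟨s, rfl⟩ : ∃ r, s = r + 1 := ⟨s - 1, by omega⟩
  have hsn : s + 1 < n := by omega
  obtain ⟨N, rfl⟩ : ∃ N, n = 1 + (i + (N + 1)) := ⟨n - i - 2, by omega⟩
  have hlist : indicatorList R 1 (i + (N + 1)) =
      List.replicate i true ++ false :: indicatorList R (i + 2) N := by
    rw [indicatorList_eq_replicate_append i (N + 1) fun y hy hyi => hmin y (by omega) (by omega),
      indicatorList]
    rw [show 1 + i + 1 = i + 1 + 1 by omega]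
    simp [hmR]
  have hlist0 : indicatorList R 0 (1 + (i + (N + 1))) =
      true :: indicatorList R 1 (i + (N + 1)) := by
    rw [show 1 + (i + (N + 1)) = i + (N + 1) + 1 by omega, indicatorList]
    simp [h1R]
  have hcount := indicatorList_count_le R 0 (1 + (i + (N + 1)))
  rw [hlist0, hlist] at hcount
  have hcount2 : i + (indicatorList R (i + 2) N).count true + 1 ≤ #R := by
    refine le_trans ?_ (hcount.trans (Finset.card_filter_le _ _))
    simp [List.count_append]
  obtain ⟨q, rfl⟩ : ∃ r, q = r + 1 := ⟨q - 1, by omega⟩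
  have hmiss : MissesLevel q (indicatorList R 1 (i + (N + 1))) := by
    rw [mem_ksubsets] at hX
    have hc : #(X.erase 1) = q := by rw [Finset.card_erase_of_mem h1X, hX.2]; rfl
    rw [← hc]
    refine missesLevel_indicatorList ?_ ?_ ?_
    · intro y hy
      have h2 := Finset.mem_erase.1 hy
      have h3 := Finset.mem_Icc.1 (hX.1 h2.2)
      exact Finset.mem_Icc.2 ⟨by omega, h3.2⟩
    · exact fun r hr => (Finset.mem_Icc.1 (hR hr)).2
    · rw [lexAbove_congr_left (A' := X) fun y hy => by
        simp only [Finset.mem_erase]; exact and_iff_right (by omega)]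
      rw [← lexAbove_zero_iff hX.1 hR] at hXR
      rwa [lexAbove_succ_of_iff (iff_of_true h1X h1R)] at hXR
  rw [hlist] at hmiss
  have key := segWeight_lt_max_subcube h.shift (N := i + (N + 1)) (s := s) (q := q) _
    (by omega) (by rw [indicatorList_length]; omega) (by push_cast at *; omega)
    (by push_cast at hsθ; omega) (by push_cast at hq; omega) (by omega) hW hmiss
  rw [hlist0, hlist, segWeight]
  rw [show 1 + (i + (N + 1)) - (s + 1) = i + (N + 1) - s by omega,
    show 1 + (i + (N + 1)) - 1 = i + (N + 1) by omega]
  exact key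

theorem segWeight_indicatorList_Icc (W : ℕ → ℤ) {n s : ℕ} (hsn : s ≤ n) :
    segWeight W (indicatorList (Icc 1 s) 0 n) = cubeWeight (fun l => W (l + s)) (n - s) := by
  obtain ⟨N, rfl⟩ : ∃ N, n = s + N := ⟨n - s, by omega⟩
  rw [indicatorList_eq_replicate_append s N (fun y h1 h2 => Finset.mem_Icc.2 ⟨h1, by omega⟩),
    segWeight_replicate_append, segWeight_of_count_eq_zero, indicatorList_length,
    show s + N - s = N by omega]
  refine Nat.le_zero.1 ((indicatorList_count_le _ _ _).trans (le_of_eq ?_))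
  rw [Finset.card_eq_zero, Finset.filter_eq_empty_iff]
  intro y hy
  have := Finset.mem_Icc.1 hy
  omega

theorem choose_sub_choose_star {n a : ℕ} (ha : 1 ≤ a) (han : a < n) :
    (n.choose a : ℤ) - (n - 1).choose (n - a - 1) = (n - 1).choose (a - 1) := by
  obtain ⟨n, rfl⟩ : ∃ m, n = m + 1 := ⟨n - 1, by omega⟩
  obtain ⟨a, rfl⟩ : ∃ m, a = m + 1 := ⟨a - 1, by omega⟩
  simp only [Nat.add_sub_cancel]
  rw [show n + 1 - (a + 1) - 1 = n - (a + 1) by omega, Nat.choose_symm (by omega),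
    Nat.choose_succ_succ]
  push_cast
  ring

/-- Two `L`-initial families that properly extend the star of `1`, the first of them not
reaching the last set of its range, together with `L`-initial families cross intersecting
both, have total size less than that of the stars or of the families determined by `[s]`. -/
theorem card_sum_lt_max {n a b s : ℕ} {ι : Type*} (J : Finset ι) (k : ι → ℕ)
    (F : ι → Finset (Finset ℕ)) (I : ι → Finset ℕ) (FA FB : Finset (Finset ℕ))
    (IA IB : Finset ℕ) (hs : 2 ≤ s) (hsJ : ∃ j ∈ J, k j = s) (hsk : ∀ j ∈ J, s ≤ k j)
    (hka : ∀ j ∈ J, a + k j ≤ n) (hba : b < a) (hb : 2 ≤ b)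
    (hI : ∀ j ∈ J, I j ∈ ksubsets n (k j)) (hF : ∀ j ∈ J, F j = Lset n (I j) (k j))
    (hFA : FA = Lset n IA a)
    (hIB : IB ∈ ksubsets n b) (hFB : FB = Lset n IB b)
    (hA : ∀ j ∈ J, CrossInt FA (F j)) (hB : ∀ j ∈ J, CrossInt FB (F j))
    (hAl : lex (insert 1 (Icc (n - a + 2) n)) IA)
    (hAr : lexLT IA (insert s (Icc (n - a + 2) n)))
    (hBl : lexLT (insert 1 (Icc (n - b + 2) n)) IB) :
    (#FA : ℤ) + #FB + ∑ j ∈ J, (#(F j) : ℤ) <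
      max (((n - 1).choose (a - 1) : ℤ) + (n - 1).choose (b - 1)
          + ∑ j ∈ J, ((n - 1).choose (k j - 1) : ℤ))
        (((n.choose a : ℤ) - (n - s).choose a) + ((n.choose b : ℤ) - (n - s).choose b)
          + ∑ j ∈ J, ((n - s).choose (k j - s) : ℤ)) := by
  obtain ⟨js, hjs, hjs'⟩ := hsJ
  have hsan : a + s ≤ n := hjs' ▸ hka js hjs
  obtain ⟨j₀, hj₀, hlast⟩ := exists_lex_last ⟨js, hjs⟩ I
  have hself : ∀ j ∈ J, I j ∈ F j := fun j hj =>
    hF j hj ▸ Finset.mem_filter.2 ⟨hI j hj, lex_refl _⟩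
  have hR := hI j₀ hj₀
  have hRF := hF j₀ hj₀
  have hRmem := hself j₀ hj₀
  have hAj := hA j₀ hj₀
  have hBj := hB j₀ hj₀
  have hkj := hka j₀ hj₀
  generalize hRdef : I j₀ = R at *
  have hRg := mem_ksubsets.1 hR
  have hFA' : FA ⊆ coInitial n a R := by
    intro A hAm
    have hAk : A ∈ ksubsets n a := by rw [hFA] at hAm; exact (Finset.mem_filter.1 hAm).1
    exact Finset.mem_filter.2 ⟨hAk, not_lex_compl_of_cross hAk hR hkj
      fun B hBm => hAj A hAm B (hRF ▸ hBm)⟩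
  have hFB' : FB ⊆ coInitial n b R := by
    intro A hAm
    have hAk : A ∈ ksubsets n b := by rw [hFB] at hAm; exact (Finset.mem_filter.1 hAm).1
    exact Finset.mem_filter.2 ⟨hAk, not_lex_compl_of_cross hAk hR (by omega)
      fun B hBm => hBj A hAm B (hRF ▸ hBm)⟩
  have hFj : ∀ j ∈ J, F j ⊆ Lset n R (k j) := by
    intro j hj X hX
    rw [hF j hj] at hX
    have hX' := Finset.mem_filter.1 hX
    exact Finset.mem_filter.2 ⟨hX'.1, lex_trans hX'.2 (hlast j hj)⟩
  have h1R : 1 ∈ R := by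
    by_contra h1
    have hsub : ({1} : Finset ℕ) ⊆ ground n \ R := by
      rw [Finset.singleton_subset_iff, Finset.mem_sdiff]
      exact ⟨Finset.mem_Icc.2 ⟨le_rfl, by omega⟩, h1⟩
    obtain ⟨A, hA1, hA2, hA3⟩ := Finset.exists_subsuperset_card_eq (n := a) hsub
      (by rw [Finset.card_singleton]; omega)
      (by rw [Finset.card_sdiff_of_subset hRg.1, card_ground, hRg.2]; omega)
    have hAk : A ∈ ksubsets n a := mem_ksubsets.2 ⟨hA2.trans Finset.sdiff_subset, hA3⟩
    have hAF : A ∈ FA := hFA ▸ Finset.mem_filter.2 ⟨hAk, lex_trans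
      (lex_last_star (by omega) (by omega) hAk (Finset.singleton_subset_iff.1 hA1)) hAl⟩
    obtain ⟨x, hx⟩ := hAj A hAF R hRmem
    rw [Finset.mem_inter] at hx
    exact (Finset.mem_sdiff.1 (hA2 hx.1)).2 hx.2
  have hsR : lex (Icc 1 s) R :=
    lex_trans (Icc_lex (hjs' ▸ hI js hjs)) (hlast js hjs)
  have hseg := segWeight_systemWeight J k (n - a) (n - b) n hRg.1
  have hcA := card_coInitial n a R (by omega)
  have hcB := card_coInitial n b R (by omega)
  have hleB := Finset.card_le_card hFB'
  have hleA := Finset.card_le_card hFA'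
  have hleJ : ∑ j ∈ J, (#(F j) : ℤ) ≤ ∑ j ∈ J, (#(Lset n R (k j)) : ℤ) :=
    Finset.sum_le_sum fun j hj => by exact_mod_cast Finset.card_le_card (hFj j hj)
  have hcube_s := cubeWeight_systemWeight J k (p := n - a) (q := n - b) (n - s) hsk
    (by omega) (by omega)
  have hcube_1 := cubeWeight_systemWeight J k (p := n - a) (q := n - b) (s := 1) (n - 1)
    (fun j hj => (by omega : 1 ≤ s).trans (hsk j hj)) (by omega) (by omega)
  have hsa := choose_sub_choose_star (n := n) (a := a) (by omega) (by omega)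
  have hsb := choose_sub_choose_star (n := n) (a := b) (by omega) (by omega)
  have hta : (n - s).choose (n - a - s) = (n - s).choose a := by
    rw [show n - a - s = n - s - a by omega, Nat.choose_symm (by omega)]
  have htb : (n - s).choose (n - b - s) = (n - s).choose b := by
    rw [show n - b - s = n - s - b by omega, Nat.choose_symm (by omega)]
  rw [hta, htb] at hcube_s
  have hcA' : (#(coInitial n a R) : ℤ) + #(Lset n R (n - a)) = n.choose a := by
    exact_mod_cast hcA
  have hcB' : (#(coInitial n b R) : ℤ) + #(Lset n R (n - b)) = n.choose b := by
    exact_mod_cast hcB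
  by_cases hRs : R = Icc 1 s
  · have hlt : #FA < #(coInitial n a R) := by
      refine Finset.card_lt_card ((Finset.ssubset_iff_of_subset hFA').2
        ⟨insert s (Icc (n - a + 2) n), ?_, ?_⟩)
      · refine Finset.mem_filter.2 ⟨mem_ksubsets.2 ⟨?_, card_insert_tail (by omega) (by omega)
          (by omega)⟩, ?_⟩
        · intro y hy
          rw [Finset.mem_insert, Finset.mem_Icc] at hy
          exact Finset.mem_Icc.2 (by omega)
        · have hs1 : s ∉ ground n \ insert s (Icc (n - a + 2) n) := by simp
          have hs2 : s ∈ Icc 1 s := Finset.mem_Icc.2 ⟨by omega, le_rfl⟩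
          rw [hRs, lex_iff]
          rintro (h | ⟨x, hx1, hx2, hx⟩)
          · exact hs1 (h ▸ hs2)
          · have hx0 := Finset.mem_Icc.1 (Finset.mem_sdiff.1 hx1).1
            rw [Finset.mem_Icc] at hx2
            exact hs1 ((hx s (by omega)).2 hs2)
      · intro hmem
        rw [hFA] at hmem
        exact hAr.2 (lex_antisymm hAr.1 (Finset.mem_filter.1 hmem).2)
    have hkey := segWeight_indicatorList_Icc (systemWeight J k (n - a) (n - b))
      (n := n) (s := s) (by omega)
    rw [← hRs] at hkey
    refine lt_max_of_lt_right ?_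
    have hlt' : (#FA : ℤ) < #(coInitial n a R) := by exact_mod_cast hlt
    have hleB' : (#FB : ℤ) ≤ #(coInitial n b R) := by exact_mod_cast hleB
    linarith
  · have h1B : 1 ∉ IB := fun h => hBl.2 (eq_of_last_star_lex hb (by omega) hIB h hBl.1)
    have hIBF : IB ∈ FB := hFB ▸ Finset.mem_filter.2 ⟨hIB, lex_refl _⟩
    have hIB' := mem_ksubsets.1 hIB
    have hkey := segWeight_lt_of_interior (s := s)
      (signChange_systemWeight J k (p := n - a) (q := n - b)
        (fun j hj => by have := hka j hj; omega) (by omega))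
      (X := ground n \ IB) hRg.1 h1R (by rw [hRg.2]; omega) hsR hRs (by omega)
      (q := n - b) (by omega) (by omega)
      (systemWeight_neg J k (fun j hj => by have := hka j hj; omega) (by omega))
      (mem_ksubsets.2 ⟨Finset.sdiff_subset, by
        rw [Finset.card_sdiff_of_subset hIB'.1, card_ground, hIB'.2]⟩)
      (Finset.mem_sdiff.2 ⟨Finset.mem_Icc.2 ⟨le_rfl, by omega⟩, h1B⟩)
      (Finset.mem_filter.1 (hFB' hIBF)).2
    have hleA' : (#FA : ℤ) ≤ #(coInitial n a R) := by exact_mod_cast hleA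
    have hleB' : (#FB : ℤ) ≤ #(coInitial n b R) := by exact_mod_cast hleB
    rcases lt_max_iff.1 hkey with h | h
    · refine lt_max_of_lt_right ?_
      linarith
    · refine lt_max_of_lt_left ?_
      linarith

theorem sum_fin_eq_add_add {M : Type*} [AddCommMonoid M] {t : ℕ} (h0 : 0 < t) (h1 : 1 < t)
    (f : Fin t → M) :
    ∑ i, f i = f ⟨0, h0⟩ + f ⟨1, h1⟩
      + ∑ i ∈ univ.filter (fun i : Fin t => 2 ≤ (i : ℕ)), f i := by
  have h : (univ : Finset (Fin t)) = insert ⟨0, h0⟩ (insert ⟨1, h1⟩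
      (univ.filter fun i : Fin t => 2 ≤ (i : ℕ))) := by
    ext i
    simp only [Finset.mem_univ, Finset.mem_insert, Finset.mem_filter, true_and, Fin.ext_iff,
      true_iff]
    omega
  conv_lhs => rw [h]
  rw [Finset.sum_insert (by simp [Fin.ext_iff]), Finset.sum_insert (by simp), add_assoc]

/-- if both IDs `I₁, I₂` of an extremal L-initial system are strictly
between the first and last sets of their ranges, then the total size is strictly
below `max {λ₁, λ₂}`. -/
theorem extremal_interior_ID (n t : ℕ) (k : Fin t → ℕ)
    (F : Fin t → Finset (Finset ℕ)) (I : Fin t → Finset ℕ)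
    (ht : 3 ≤ t)
    (hanti : ∀ i j : Fin t, i ≤ j → k j ≤ k i)
    (h12 : k ⟨1, by omega⟩ < k ⟨0, by omega⟩)
    (hkt : 2 ≤ k ⟨t - 1, by omega⟩)
    (hn1 : k ⟨0, by omega⟩ + k ⟨2, by omega⟩ ≤ n)
    (hn2 : n < k ⟨0, by omega⟩ + k ⟨1, by omega⟩)
    (hext : Extremal n k F)
    (hID : ∀ i, I i ∈ ksubsets n (k i) ∧ F i = Lset n (I i) (k i))
    (lam1 lam2 : ℕ)
    (hlam1 : lam1 = ∑ i, Nat.choose (n - 1) (k i - 1))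
    (hlam2 : lam2 =
      (Nat.choose n (k ⟨0, by omega⟩) -
        Nat.choose (n - k ⟨t - 1, by omega⟩) (k ⟨0, by omega⟩)) +
      (Nat.choose n (k ⟨1, by omega⟩) -
        Nat.choose (n - k ⟨t - 1, by omega⟩) (k ⟨1, by omega⟩)) +
      ∑ i ∈ Finset.univ.filter (fun i : Fin t => 2 ≤ (i : ℕ)),
        Nat.choose (n - k ⟨t - 1, by omega⟩) (k i - k ⟨t - 1, by omega⟩))
    (hI1l : lexLT (insert 1 (Finset.Icc (n - k ⟨0, by omega⟩ + 2) n)) (I ⟨0, by omega⟩))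
    (hI1r : lexLT (I ⟨0, by omega⟩)
      (insert (k ⟨t - 1, by omega⟩) (Finset.Icc (n - k ⟨0, by omega⟩ + 2) n)))
    (hI2l : lexLT (insert 1 (Finset.Icc (n - k ⟨1, by omega⟩ + 2) n)) (I ⟨1, by omega⟩))
    (hI2r : lexLT (I ⟨1, by omega⟩)
      (insert (k ⟨t - 1, by omega⟩) (Finset.Icc (n - k ⟨1, by omega⟩ + 2) n))) :
    ∑ i, (F i).card < max lam1 lam2 := by
  have hlast : ∀ j ∈ univ.filter (fun i : Fin t => 2 ≤ (i : ℕ)),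
      k ⟨t - 1, by omega⟩ ≤ k j := fun j _ =>
    hanti j ⟨t - 1, by omega⟩ (by rw [Fin.le_def]; simp only; omega)
  have hthird : ∀ j ∈ univ.filter (fun i : Fin t => 2 ≤ (i : ℕ)),
      k j ≤ k ⟨2, by omega⟩ := fun j hj =>
    hanti ⟨2, by omega⟩ j (Finset.mem_filter.1 hj).2
  have hkn : k ⟨1, by omega⟩ ≤ n := by omega
  have htwo : 2 ≤ k ⟨1, by omega⟩ :=
    hkt.trans (hanti ⟨1, by omega⟩ ⟨t - 1, by omega⟩ (by rw [Fin.le_def]; simp only; omega))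
  have key := card_sum_lt_max (univ.filter (fun i : Fin t => 2 ≤ (i : ℕ))) k F I
    (F ⟨0, by omega⟩) (F ⟨1, by omega⟩) (I ⟨0, by omega⟩) (I ⟨1, by omega⟩)
    hkt ⟨⟨t - 1, by omega⟩, Finset.mem_filter.2 ⟨Finset.mem_univ _, by simp only; omega⟩, rfl⟩
    hlast (fun j hj => by have := hthird j hj; omega) h12 htwo
    (fun j _ => (hID j).1) (fun j _ => (hID j).2)
    (hID _).2 (hID _).1 (hID _).2
    (fun j hj => hext.1.2.2 _ j (by
      have := (Finset.mem_filter.1 hj).2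
      rw [Fin.lt_def]; simp only; omega))
    (fun j hj => hext.1.2.2 _ j (by
      have := (Finset.mem_filter.1 hj).2
      rw [Fin.lt_def]; simp only; omega))
    hI1l.1 hI1r hI2l
  have hle : ∀ c : ℕ, (n - k ⟨t - 1, by omega⟩).choose c ≤ n.choose c := fun c =>
    Nat.choose_le_choose c (Nat.sub_le _ _)
  rw [sum_fin_eq_add_add (by omega) (by omega)] at hlam1 ⊢
  rw [← Nat.cast_lt (α := ℤ), Nat.cast_max, hlam1, hlam2]
  push_cast [hle]
  exact key
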